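/- arXiv:1907.11506 — 2 statements merged into one kernel-verified Lean document; each statement's English description precedes it below -/
import Mathlib

section
/- Let F be an algebraically closed field with char F ≠ 2, let V be an F-vector space of finite odd dimension n, and let Q be a nondegenerate quadratic form on V. Then the Clifford algebra Cl(V,Q) is isomorphic as an F-algebra to the direct sum M_{2^{(n-1)/2}}(F) ⊕ M_{2^{(n-1)/2}}(F) of two copies of the matrix algebra M_{2^{(n-1)/2}}(F). -/
open QuadraticMap

universe u

/-- The algebra homomorphism out of a matrix algebra determined by a system of matrix units
commuting with the image of the coefficients. -/
noncomputable def Matrix.liftMatrixUnits {R A B n : Type*} [CommSemiring R] [Semiring A]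
    [Semiring B] [Algebra R A] [Algebra R B] [Fintype n] [DecidableEq n]
    (g : A →ₐ[R] B) (e : Matrix n n B)
    (hmul : ∀ i j k l, e i j * e k l = if j = k then e i l else 0)
    (hone : ∑ i, e i i = 1) (hcomm : ∀ a i j, Commute (g a) (e i j)) :
    Matrix n n A →ₐ[R] B :=
  AlgHom.ofLinearMap
    { toFun := fun M => ∑ i, ∑ j, g (M i j) * e i j
      map_add' := fun M N => by
        simp [add_mul, Finset.sum_add_distrib]
      map_smul' := fun r M => by
        simp [Finset.smul_sum] }
    (by simpa [Matrix.one_apply, apply_ite g, ite_mul] using hone)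
    (fun M N => by
      have key (i j k l : n) : g (M i j) * e i j * (g (N k l) * e k l) =
          if j = k then g (M i j * N k l) * e i l else 0 := by
        rw [mul_assoc, ← mul_assoc (e i j), ← (hcomm (N k l) i j).eq, mul_assoc, hmul,
          map_mul, mul_assoc]
        split_ifs <;> simp
      simp only [LinearMap.coe_mk, AddHom.coe_mk, Finset.sum_mul_sum, key, Matrix.mul_apply,
        map_sum]
      refine Finset.sum_congr rfl fun i _ => ?_
      have collapse (j : n) : ∑ k, ∑ l, (if j = k then g (M i j * N k l) * e i l else 0) =
          ∑ l, g (M i j * N j l) * e i l := by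
        rw [Finset.sum_comm]
        simp
      simp only [Finset.sum_mul]
      rw [Finset.sum_comm]
      conv_rhs => rw [Finset.sum_comm]
      simp only [collapse])

@[simp]
theorem Matrix.liftMatrixUnits_apply {R A B n : Type*} [CommSemiring R] [Semiring A]
    [Semiring B] [Algebra R A] [Algebra R B] [Fintype n] [DecidableEq n]
    (g : A →ₐ[R] B) (e : Matrix n n B)
    (hmul : ∀ i j k l, e i j * e k l = if j = k then e i l else 0)
    (hone : ∑ i, e i i = 1) (hcomm : ∀ a i j, Commute (g a) (e i j)) (M : Matrix n n A) :
    Matrix.liftMatrixUnits g e hmul hone hcomm M = ∑ i, ∑ j, g (M i j) * e i j := rfl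

/-- Square matrices over a product of algebras are pairs of square matrices. -/
noncomputable def Matrix.prodAlgEquiv (R A B n : Type*) [CommSemiring R] [Semiring A] [Semiring B]
    [Algebra R A] [Algebra R B] [Fintype n] [DecidableEq n] :
    Matrix n n (A × B) ≃ₐ[R] Matrix n n A × Matrix n n B :=
  AlgEquiv.ofBijective
    ((AlgHom.fst R A B).mapMatrix.prod (AlgHom.snd R A B).mapMatrix)
    ⟨fun M N h => by
      ext i j
      · exact congrFun₂ (congrArg Prod.fst h) i j
      · exact congrFun₂ (congrArg Prod.snd h) i j,
    fun M => ⟨fun i j => (M.1 i j, M.2 i j), rfl⟩⟩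

/-- The `1 × 1` matrices over a commutative semiring are the scalars. -/
noncomputable def Matrix.finOneAlgEquiv (R : Type*) [CommSemiring R] :
    R ≃ₐ[R] Matrix (Fin 1) (Fin 1) R :=
  AlgEquiv.ofBijective (Matrix.scalarAlgHom (Fin 1) R)
    ⟨fun a b h => by simpa using congrFun₂ h 0 0,
    fun M => ⟨M 0 0, by ext i j; fin_cases i; fin_cases j; simp⟩⟩

/-- The hyperbolic plane `(a, b) ↦ a * b`. -/
def QuadraticForm.hyperbolicPlane (R : Type*) [CommRing R] : QuadraticForm R (R × R) :=
  linMulLin (LinearMap.fst R R R) (LinearMap.snd R R R)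

@[simp]
theorem QuadraticForm.hyperbolicPlane_apply {R : Type*} [CommRing R] (x : R × R) :
    QuadraticForm.hyperbolicPlane R x = x.1 * x.2 := rfl

/-- A pair of square-zero elements generating a copy of the Clifford algebra of a hyperbolic
plane. -/
structure IsHyperbolicPair {A : Type*} [Ring A] (f g : A) : Prop where
  left_sq : f * f = 0
  right_sq : g * g = 0
  mul_add_swap : f * g + g * f = 1

namespace IsHyperbolicPair

variable {A : Type*} [Ring A] {f g x : A}

theorem left_mul_right_mul_left (h : IsHyperbolicPair f g) : f * g * f = f := by
  rw [eq_sub_of_add_eq h.mul_add_swap, sub_mul, mul_assoc, h.left_sq, mul_zero, sub_zero, one_mul]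

theorem right_mul_left_mul_right (h : IsHyperbolicPair f g) : g * f * g = g := by
  rw [eq_sub_of_add_eq' h.mul_add_swap, sub_mul, mul_assoc, h.right_sq, mul_zero, sub_zero,
    one_mul]

theorem matrixUnits_mul (h : IsHyperbolicPair f g) (i j k l : Fin 2) :
    !![f * g, f; g, g * f] i j * !![f * g, f; g, g * f] k l =
      if j = k then !![f * g, f; g, g * f] i l else 0 := by
  have hf := h.left_mul_right_mul_left
  have hg := h.right_mul_left_mul_right
  have hf' := h.left_sq
  have hg' := h.right_sq
  fin_cases i <;> fin_cases j <;> fin_cases k <;> fin_cases l <;>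
    simp [← mul_assoc, hf, hg, hf', hg', mul_assoc f g g, mul_assoc g f f]

theorem twist_mul_twist (h : IsHyperbolicPair f g) :
    (f * g - g * f) * (f * g - g * f) = 1 := by
  rw [← h.mul_add_swap]
  simp only [mul_sub, sub_mul, ← mul_assoc, h.left_mul_right_mul_left,
    h.right_mul_left_mul_right, mul_assoc f g g, mul_assoc g f f, h.left_sq, h.right_sq]
  simp

theorem commute_twist (hf : x * f = -(f * x)) (hg : x * g = -(g * x)) :
    Commute x (f * g - g * f) := by
  have h₁ : x * (f * g) = f * g * x := by
    rw [← mul_assoc, hf, neg_mul, mul_assoc, hg, mul_neg, neg_neg, mul_assoc]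
  have h₂ : x * (g * f) = g * f * x := by
    rw [← mul_assoc, hg, neg_mul, mul_assoc, hf, mul_neg, neg_neg, mul_assoc]
  rw [commute_iff_eq, mul_sub, sub_mul, h₁, h₂]

theorem twist_mul_self (h : IsHyperbolicPair f g) (hf : x * f = -(f * x))
    (hg : x * g = -(g * x)) :
    x * (f * g - g * f) * (x * (f * g - g * f)) = x * x := by
  rw [(commute_twist hf hg).symm.mul_mul_mul_comm, h.twist_mul_twist, mul_one]

theorem commute_twist_left (h : IsHyperbolicPair f g) (hf : x * f = -(f * x)) :
    Commute (x * (f * g - g * f)) f := by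
  rw [commute_iff_eq, ← mul_assoc, ← neg_eq_iff_eq_neg.mpr hf]
  simp [mul_assoc, sub_mul, mul_sub, h.left_sq]
  simp [← mul_assoc, h.left_sq]

theorem commute_twist_right (h : IsHyperbolicPair f g) (hg : x * g = -(g * x)) :
    Commute (x * (f * g - g * f)) g := by
  rw [commute_iff_eq, ← mul_assoc, ← neg_eq_iff_eq_neg.mpr hg]
  simp [mul_assoc, sub_mul, mul_sub, h.right_sq]
  simp [← mul_assoc, h.right_sq]

end IsHyperbolicPair

namespace CliffordAlgebra

open QuadraticForm

section Hyperbolic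

variable {R V : Type*} [CommRing R] [AddCommGroup V] [Module R V] (Q : QuadraticForm R V)

/-- The map from the Clifford algebra of `Q ⟂ H` to `2 × 2` matrices over the Clifford algebra
of `Q`, where `H` is the hyperbolic plane. -/
def prodHyperbolicToMatrix :
    CliffordAlgebra (Q.prod (hyperbolicPlane R)) →ₐ[R]
      Matrix (Fin 2) (Fin 2) (CliffordAlgebra Q) :=
  lift _ ⟨
    { toFun := fun x => !![ι Q x.1, algebraMap R _ x.2.1; algebraMap R _ x.2.2, -ι Q x.1]
      map_add' := fun x y => by
        ext i j; fin_cases i <;> fin_cases j <;> simp [add_comm]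
      map_smul' := fun r x => by
        ext i j; fin_cases i <;> fin_cases j <;> simp [Algebra.smul_def] },
    fun x => by
      ext i j
      have ha := Algebra.commutes x.2.1 (ι Q x.1)
      have hb := Algebra.commutes x.2.2 (ι Q x.1)
      fin_cases i <;> fin_cases j <;>
        simp [Matrix.mul_apply, Matrix.algebraMap_matrix_apply, ha, hb, add_comm, ← map_mul,
          mul_comm x.2.2]⟩

@[simp]
theorem prodHyperbolicToMatrix_ι (x : V × R × R) :
    prodHyperbolicToMatrix Q (ι _ x) =
      !![ι Q x.1, algebraMap R _ x.2.1; algebraMap R _ x.2.2, -ι Q x.1] :=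
  lift_ι_apply _ _ _

/-- The first isotropic vector of the hyperbolic plane in the Clifford algebra of `Q ⟂ H`. -/
def hyperbolicLeft : CliffordAlgebra (Q.prod (hyperbolicPlane R)) := ι _ (0, 1, 0)

/-- The second isotropic vector of the hyperbolic plane in the Clifford algebra of `Q ⟂ H`. -/
def hyperbolicRight : CliffordAlgebra (Q.prod (hyperbolicPlane R)) := ι _ (0, 0, 1)

theorem isHyperbolicPair_hyperbolicLeft_hyperbolicRight :
    IsHyperbolicPair (hyperbolicLeft Q) (hyperbolicRight Q) where
  left_sq := by simp [hyperbolicLeft]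
  right_sq := by simp [hyperbolicRight]
  mul_add_swap := by
    rw [hyperbolicLeft, hyperbolicRight, ι_mul_ι_add_swap]
    simp [polar]

theorem ι_mul_hyperbolicLeft (v : V) :
    ι _ (v, 0) * hyperbolicLeft Q = -(hyperbolicLeft Q * ι _ (v, 0)) := by
  apply ι_mul_ι_comm_of_isOrtho
  simp [isOrtho_def]

theorem ι_mul_hyperbolicRight (v : V) :
    ι _ (v, 0) * hyperbolicRight Q = -(hyperbolicRight Q * ι _ (v, 0)) := by
  apply ι_mul_ι_comm_of_isOrtho
  simp [isOrtho_def]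

/-- The embedding of the Clifford algebra of `Q` into that of `Q ⟂ H` whose image centralizes
the hyperbolic plane `H`. -/
def twistedInl : CliffordAlgebra Q →ₐ[R] CliffordAlgebra (Q.prod (hyperbolicPlane R)) :=
  lift _ ⟨LinearMap.mulRight R
      (hyperbolicLeft Q * hyperbolicRight Q - hyperbolicRight Q * hyperbolicLeft Q) ∘ₗ
      ι _ ∘ₗ LinearMap.inl R V (R × R),
    fun v => by
      have h := (isHyperbolicPair_hyperbolicLeft_hyperbolicRight Q).twist_mul_self
        (ι_mul_hyperbolicLeft Q v) (ι_mul_hyperbolicRight Q v)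
      simpa using h⟩

@[simp]
theorem twistedInl_ι (v : V) :
    twistedInl Q (ι Q v) = ι _ (v, 0) *
      (hyperbolicLeft Q * hyperbolicRight Q - hyperbolicRight Q * hyperbolicLeft Q) :=
  lift_ι_apply _ _ _

theorem commute_twistedInl_of_ι {x : CliffordAlgebra (Q.prod (hyperbolicPlane R))}
    (h : ∀ v, Commute (twistedInl Q (ι Q v)) x) (a : CliffordAlgebra Q) :
    Commute (twistedInl Q a) x := by
  induction a using CliffordAlgebra.induction with
  | algebraMap r => simpa using Algebra.commute_algebraMap_left r x
  | ι v => exact h v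
  | mul a b ha hb => simpa using ha.mul_left hb
  | add a b ha hb => simpa using ha.add_left hb

theorem commute_twistedInl_hyperbolicLeft (a : CliffordAlgebra Q) :
    Commute (twistedInl Q a) (hyperbolicLeft Q) :=
  commute_twistedInl_of_ι Q (fun v => by
    rw [twistedInl_ι]
    exact (isHyperbolicPair_hyperbolicLeft_hyperbolicRight Q).commute_twist_left
      (ι_mul_hyperbolicLeft Q v)) a

theorem commute_twistedInl_hyperbolicRight (a : CliffordAlgebra Q) :
    Commute (twistedInl Q a) (hyperbolicRight Q) :=
  commute_twistedInl_of_ι Q (fun v => by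
    rw [twistedInl_ι]
    exact (isHyperbolicPair_hyperbolicLeft_hyperbolicRight Q).commute_twist_right
      (ι_mul_hyperbolicRight Q v)) a

/-- The inverse of `prodHyperbolicToMatrix`. -/
noncomputable def matrixToProdHyperbolic :
    Matrix (Fin 2) (Fin 2) (CliffordAlgebra Q) →ₐ[R]
      CliffordAlgebra (Q.prod (hyperbolicPlane R)) :=
  Matrix.liftMatrixUnits (twistedInl Q)
    !![hyperbolicLeft Q * hyperbolicRight Q, hyperbolicLeft Q;
      hyperbolicRight Q, hyperbolicRight Q * hyperbolicLeft Q]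
    (isHyperbolicPair_hyperbolicLeft_hyperbolicRight Q).matrixUnits_mul
    (by simpa using (isHyperbolicPair_hyperbolicLeft_hyperbolicRight Q).mul_add_swap)
    (fun a i j => by
      have hl := commute_twistedInl_hyperbolicLeft Q a
      have hr := commute_twistedInl_hyperbolicRight Q a
      fin_cases i <;> fin_cases j
      exacts [hl.mul_right hr, hl, hr, hr.mul_right hl])

theorem matrixToProdHyperbolic_apply (M : Matrix (Fin 2) (Fin 2) (CliffordAlgebra Q)) :
    matrixToProdHyperbolic Q M =
      twistedInl Q (M 0 0) * (hyperbolicLeft Q * hyperbolicRight Q) +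
        twistedInl Q (M 0 1) * hyperbolicLeft Q +
        (twistedInl Q (M 1 0) * hyperbolicRight Q +
          twistedInl Q (M 1 1) * (hyperbolicRight Q * hyperbolicLeft Q)) := by
  simp [matrixToProdHyperbolic, Fin.sum_univ_two]

theorem matrixToProdHyperbolic_comp_prodHyperbolicToMatrix :
    (matrixToProdHyperbolic Q).comp (prodHyperbolicToMatrix Q) = AlgHom.id R _ := by
  refine hom_ext (LinearMap.ext fun x => ?_)
  obtain ⟨v, a, b⟩ := x
  have hx : ι (Q.prod (hyperbolicPlane R)) (v, a, b) =
      ι _ (v, 0) + a • hyperbolicLeft Q + b • hyperbolicRight Q := by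
    simp [hyperbolicLeft, hyperbolicRight, ← map_smul, ← map_add]
  have hw := congrArg (ι (Q.prod (hyperbolicPlane R)) (v, 0) * ·)
    (isHyperbolicPair_hyperbolicLeft_hyperbolicRight Q).twist_mul_twist
  simp only [mul_one] at hw
  simp only [AlgHom.toLinearMap_apply, LinearMap.comp_apply, AlgHom.comp_apply,
    prodHyperbolicToMatrix_ι, matrixToProdHyperbolic_apply, AlgHom.id_apply]
  rw [hx]
  simp only [Matrix.of_apply, Matrix.cons_val', Matrix.cons_val_zero, Matrix.cons_val_one,
    Matrix.cons_val_fin_one, map_neg, twistedInl_ι, AlgHom.commutes, ← Algebra.smul_def]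
  rw [← mul_assoc, mul_sub] at hw
  conv_rhs => rw [← hw]
  noncomm_ring

theorem prodHyperbolicToMatrix_twistedInl (a : CliffordAlgebra Q) :
    prodHyperbolicToMatrix Q (twistedInl Q a) = !![a, 0; 0, a] := by
  have h : (prodHyperbolicToMatrix Q).comp (twistedInl Q) =
      Matrix.scalarAlgHom (Fin 2) R := by
    refine hom_ext (LinearMap.ext fun v => ?_)
    ext i j
    fin_cases i <;> fin_cases j <;> simp [hyperbolicLeft, hyperbolicRight, Matrix.mul_apply]
  refine (DFunLike.congr_fun h a).trans ?_
  ext i j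
  fin_cases i <;> fin_cases j <;> simp

theorem prodHyperbolicToMatrix_comp_matrixToProdHyperbolic :
    (prodHyperbolicToMatrix Q).comp (matrixToProdHyperbolic Q) = AlgHom.id R _ := by
  refine AlgHom.ext fun M => ?_
  rw [AlgHom.comp_apply, matrixToProdHyperbolic_apply]
  simp only [map_add, map_mul, prodHyperbolicToMatrix_twistedInl]
  ext i j
  fin_cases i <;> fin_cases j <;> simp [hyperbolicLeft, hyperbolicRight]

/-- The Clifford algebra of `Q ⟂ H`, where `H` is the hyperbolic plane, is the algebra of
`2 × 2` matrices over the Clifford algebra of `Q`. -/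
noncomputable def prodHyperbolicEquiv :
    CliffordAlgebra (Q.prod (hyperbolicPlane R)) ≃ₐ[R]
      Matrix (Fin 2) (Fin 2) (CliffordAlgebra Q) :=
  AlgEquiv.ofAlgHom (prodHyperbolicToMatrix Q) (matrixToProdHyperbolic Q)
    (prodHyperbolicToMatrix_comp_matrixToProdHyperbolic Q)
    (matrixToProdHyperbolic_comp_prodHyperbolicToMatrix Q)

end Hyperbolic

section Line

variable (F : Type*) [Field F]

/-- The map from the Clifford algebra of the form `x ↦ x * x` on a line to `F × F`. -/
def sqToProd : CliffordAlgebra (sq : QuadraticForm F F) →ₐ[F] F × F :=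
  lift _ ⟨LinearMap.prod LinearMap.id (-LinearMap.id), fun x => by ext <;> simp⟩

@[simp]
theorem sqToProd_ι (x : F) : sqToProd F (ι sq x) = (x, -x) := lift_ι_apply _ _ _

variable [NeZero (2 : F)]

/-- The inverse of `sqToProd`. -/
noncomputable def prodToSq : F × F →ₐ[F] CliffordAlgebra (sq : QuadraticForm F F) :=
  have h_sq : ι (sq : QuadraticForm F F) 1 * ι sq 1 = 1 := by simp
  have h_two : (2 : F) ≠ 0 := NeZero.ne 2
  AlgHom.ofLinearMap
    (LinearMap.coprod
      (LinearMap.toSpanSingleton F _ ((2⁻¹ : F) • (1 + ι sq 1)))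
      (LinearMap.toSpanSingleton F _ ((2⁻¹ : F) • (1 - ι sq 1))))
    (by
      simp only [LinearMap.coprod_apply, LinearMap.toSpanSingleton_apply, Prod.fst_one,
        Prod.snd_one]
      match_scalars <;> field_simp <;> ring)
    (fun x y => by
      simp only [LinearMap.coprod_apply, LinearMap.toSpanSingleton_apply, Prod.fst_mul,
        Prod.snd_mul, add_mul, mul_add, smul_mul_smul_comm, sub_mul, mul_sub, h_sq, one_mul,
        mul_one]
      match_scalars <;> field_simp <;> ring)

theorem prodToSq_apply (x : F × F) :
    prodToSq F x = x.1 • (2⁻¹ : F) • (1 + ι sq 1) + x.2 • (2⁻¹ : F) • (1 - ι sq 1) := rfl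

/-- The Clifford algebra of the form `x ↦ x * x` on a line is split. -/
noncomputable def sqEquiv : CliffordAlgebra (sq : QuadraticForm F F) ≃ₐ[F] F × F :=
  have h_two : (2 : F) ≠ 0 := NeZero.ne 2
  AlgEquiv.ofAlgHom (sqToProd F) (prodToSq F)
    (AlgHom.ext fun x => by
      ext <;> simp [prodToSq_apply] <;> field_simp <;> ring)
    (hom_ext (LinearMap.ext_ring (by
      simp only [LinearMap.comp_apply, AlgHom.toLinearMap_apply, AlgHom.comp_apply, sqToProd_ι,
        prodToSq_apply, AlgHom.id_apply]
      match_scalars <;> field_simp <;> ring)))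

end Line

end CliffordAlgebra

namespace QuadraticForm

theorem separatingLeft_associated_iff {F V : Type*} [Field F] [Invertible (2 : F)]
    [AddCommGroup V] [Module F V] (Q : QuadraticForm F V) :
    (associated Q).SeparatingLeft ↔ (polarBilin Q).SeparatingLeft := by
  simp [LinearMap.SeparatingLeft, associated_apply, polar, Invertible.ne_zero (2 : F)]

theorem equivalent_of_finrank_eq {F V W : Type*} [Field F] [IsAlgClosed F] [Invertible (2 : F)]
    [AddCommGroup V] [Module F V] [FiniteDimensional F V]
    [AddCommGroup W] [Module F W] [FiniteDimensional F W]
    (h : Module.finrank F V = Module.finrank F W)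
    {Q : QuadraticForm F V} {Q' : QuadraticForm F W}
    (hQ : (polarBilin Q).SeparatingLeft) (hQ' : (polarBilin Q').SeparatingLeft) :
    Q.Equivalent Q' := by
  have e := equivalent_weightedSumSquares_of_isAlgClosed Q (Q.separatingLeft_associated_iff.2 hQ)
  rw [h] at e
  exact e.trans (equivalent_weightedSumSquares_of_isAlgClosed Q'
    (Q'.separatingLeft_associated_iff.2 hQ')).symm

theorem separatingLeft_polarBilin_prod_hyperbolicPlane {R V : Type*} [CommRing R]
    [AddCommGroup V] [Module R V] {Q : QuadraticForm R V} (hQ : (polarBilin Q).SeparatingLeft) :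
    (polarBilin (Q.prod (hyperbolicPlane R))).SeparatingLeft := by
  rintro ⟨v, a, b⟩ h
  have hv : v = 0 := hQ v fun w => by simpa [polar] using h (w, 0, 0)
  have ha : a = 0 := by simpa [polar, mul_add] using h (0, 0, 1)
  have hb : b = 0 := by simpa [polar, add_mul] using h (0, 1, 0)
  rw [hv, ha, hb]
  rfl

end QuadraticForm

open QuadraticForm in
/-- In each odd dimension, some nondegenerate form has split Clifford algebra. -/
theorem CliffordAlgebra.exists_equiv_matrix_prod_matrix (F : Type u) [Field F]
    [NeZero (2 : F)] (k : ℕ) :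
    ∃ (V : Type u) (_ : AddCommGroup V) (_ : Module F V) (_ : FiniteDimensional F V)
      (Q : QuadraticForm F V), Module.finrank F V = 2 * k + 1 ∧ (polarBilin Q).SeparatingLeft ∧
      Nonempty (CliffordAlgebra Q ≃ₐ[F]
        Matrix (Fin (2 ^ k)) (Fin (2 ^ k)) F × Matrix (Fin (2 ^ k)) (Fin (2 ^ k)) F) := by
  induction k with
  | zero =>
    refine ⟨F, inferInstance, inferInstance, inferInstance, sq, by simp, fun x hx => ?_,
      ⟨(sqEquiv F).trans (AlgEquiv.prodCongr ?_ ?_)⟩⟩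
    · have h := hx 1
      rw [polarBilin_apply_apply, polar, sq_apply, sq_apply, sq_apply] at h
      have h' : 2 * x = 0 := by linear_combination h
      exact (mul_eq_zero.1 h').resolve_left (NeZero.ne 2)
    all_goals exact Matrix.finOneAlgEquiv F
  | succ k ih =>
    obtain ⟨V, _, _, _, Q, hV, hQ, ⟨e⟩⟩ := ih
    let d : Matrix (Fin 2) (Fin 2) (Matrix (Fin (2 ^ k)) (Fin (2 ^ k)) F) ≃ₐ[F]
        Matrix (Fin (2 ^ (k + 1))) (Fin (2 ^ (k + 1))) F :=
      (Matrix.compAlgEquiv (Fin 2) (Fin (2 ^ k)) F F).trans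
        (Matrix.reindexAlgEquiv F F
          (finProdFinEquiv.trans (finCongr (by rw [pow_succ, mul_comm]))))
    refine ⟨V × F × F, inferInstance, inferInstance, inferInstance,
      Q.prod (hyperbolicPlane F), ?_, separatingLeft_polarBilin_prod_hyperbolicPlane hQ,
      ⟨(prodHyperbolicEquiv Q).trans (e.mapMatrix.trans
        ((Matrix.prodAlgEquiv F _ _ (Fin 2)).trans (AlgEquiv.prodCongr d d)))⟩⟩
    rw [Module.finrank_prod, Module.finrank_prod, hV, Module.finrank_self]
    ring

theorem stmt_7 (F : Type*) [Field F] [IsAlgClosed F] (hchar : ringChar F ≠ 2)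
    (V : Type*) [AddCommGroup V] [Module F V] [FiniteDimensional F V]
    (n : ℕ) (hn : Module.finrank F V = n) (hnodd : Odd n)
    (Q : QuadraticForm F V)
    (hQ : LinearMap.BilinForm.Nondegenerate (QuadraticMap.polarBilin Q)) :
    Nonempty (CliffordAlgebra Q ≃ₐ[F]
      (Matrix (Fin (2 ^ ((n - 1) / 2))) (Fin (2 ^ ((n - 1) / 2))) F ×
        Matrix (Fin (2 ^ ((n - 1) / 2))) (Fin (2 ^ ((n - 1) / 2))) F)) := by
  have h_two : (2 : F) ≠ 0 := Ring.two_ne_zero hchar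
  have : NeZero (2 : F) := ⟨h_two⟩
  have : Invertible (2 : F) := invertibleOfNonzero h_two
  obtain ⟨k, rfl⟩ := hnodd
  obtain ⟨W, _, _, _, Q', hW, hQ', ⟨e⟩⟩ := CliffordAlgebra.exists_equiv_matrix_prod_matrix F k
  obtain ⟨f⟩ := QuadraticForm.equivalent_of_finrank_eq (hn.trans hW.symm) hQ.1 hQ'
  have hk : (2 * k + 1 - 1) / 2 = k := by omega
  rw [hk]
  exact ⟨(CliffordAlgebra.equivOfIsometry f).trans e⟩
end

section
/- Let F be an algebraically closed field, l > 1 an integer coprime to the characteristic of F, ξ ∈ F a primitive l-th root of unity, and I an infinite linearly ordered set. Then the generalized Clifford algebra Clg(l,I) is a unital locally matrix F-algebra and D(Clg(l,I)) = { d : d divides l^k for some k ∈ ℕ } (equivalently, the Steinitz number of Clg(l,I) is l^∞). -/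
/-- `D(A)`: the set of positive integers `n` such that `A` contains a unital subalgebra
isomorphic to the `n × n` matrix algebra over `F`. -/
def matrixDegreeSet (F : Type*) [Field F] (A : Type*) [Ring A] [Algebra F A] : Set ℕ :=
  {n | 0 < n ∧ ∃ S : Subalgebra F A, Nonempty (S ≃ₐ[F] Matrix (Fin n) (Fin n) F)}

/-- A unital `F`-algebra is a locally matrix algebra if every finite subset lies in a
unital subalgebra isomorphic to a matrix algebra `M_n(F)`, `n ≥ 1`. -/
def IsLocallyMatrixAlgebra (F : Type*) [Field F] (A : Type*) [Ring A] [Algebra F A] : Prop :=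
  ∀ s : Finset A, ∃ (n : ℕ) (S : Subalgebra F A), 0 < n ∧ (s : Set A) ⊆ S ∧
    Nonempty (S ≃ₐ[F] Matrix (Fin n) (Fin n) F)

/-- The defining relations of the generalized Clifford algebra: `xᵢ^l = 1` and
`xⱼ xᵢ = ξ • (xᵢ xⱼ)` for `i < j`. -/
inductive ClgRel (F : Type*) [Field F] (l : ℕ) (ξ : F) {I : Type*} [LinearOrder I] :
    FreeAlgebra F I → FreeAlgebra F I → Prop
  | pow (i : I) : ClgRel F l ξ (FreeAlgebra.ι F i ^ l) 1
  | comm {i j : I} (hij : i < j) :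
      ClgRel F l ξ (FreeAlgebra.ι F j * FreeAlgebra.ι F i)
        (ξ • (FreeAlgebra.ι F i * FreeAlgebra.ι F j))

/-- The generalized Clifford algebra on a linearly ordered set of generators. -/
abbrev Clg (F : Type*) [Field F] (l : ℕ) (ξ : F) (I : Type*) [LinearOrder I] :=
  RingQuot (ClgRel F l ξ (I := I))

/-- A complete system of matrix units in `A` defines a homomorphism from a matrix algebra. -/
theorem exists_algHom_of_matrixUnits {F A ι : Type*} [Field F] [Ring A] [Algebra F A]
    [Fintype ι] [DecidableEq ι] (E : ι → ι → A)
    (hmul : ∀ i j k m, E i j * E k m = if j = k then E i m else 0)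
    (hone : ∑ i, E i i = 1) :
    ∃ f : Matrix ι ι F →ₐ[F] A, ∀ M, f M = ∑ i, ∑ j, M i j • E i j := by
  let L : Matrix ι ι F →ₗ[F] A :=
    { toFun := fun M => ∑ i, ∑ j, M i j • E i j
      map_add' := fun M N => by
        simp only [Matrix.add_apply, add_smul, Finset.sum_add_distrib]
      map_smul' := fun c M => by
        simp only [Matrix.smul_apply, smul_eq_mul, mul_smul, Finset.smul_sum, RingHom.id_apply] }
  refine ⟨AlgHom.ofLinearMap L ?_ ?_, fun M => rfl⟩
  · simp [L, Matrix.one_apply, ite_smul, hone]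
  · intro M N
    change ∑ i, ∑ j, (M * N) i j • E i j =
      (∑ i, ∑ j, M i j • E i j) * ∑ i, ∑ j, N i j • E i j
    simp only [Finset.sum_mul, Finset.mul_sum, smul_mul_smul_comm, hmul, smul_ite, smul_zero,
      Matrix.mul_apply, Finset.sum_smul]
    simp only [Finset.sum_ite_eq', Finset.mem_univ, if_true]
    conv_rhs => rw [Finset.sum_comm]
    conv_rhs => enter [2, j]; rw [Finset.sum_comm]
    exact Finset.sum_comm

/-- Two characters of `ℤ/l` in `A` commuting up to a primitive bicharacter generate an image of
the algebra of `l × l` matrices. -/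
theorem exists_algHom_of_addChar {F A : Type*} [Field F] [Ring A] [Algebra F A] {l : ℕ} [NeZero l]
    (hl : (l : F) ≠ 0) (χ : AddChar (ZMod l) F) (hχ : χ.IsPrimitive)
    (U V : AddChar (ZMod l) A) (hUV : ∀ a b, V a * U b = χ (a * b) • (U b * V a)) :
    ∃ f : Matrix (ZMod l) (ZMod l) F →ₐ[F] A, (∀ a, U a ∈ f.range ∧ V a ∈ f.range) ∧
      ∀ z, (∀ a, Commute z (U a) ∧ Commute z (V a)) → ∀ M, Commute z (f M) := by
  set e : A := (l : F)⁻¹ • ∑ b, U b with he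
  have hUe (b) : U b * e = e := by
    rw [he, mul_smul_comm, Finset.mul_sum]
    simp only [← AddChar.map_add_eq_mul]
    rw [Fintype.sum_equiv (Equiv.addLeft b) (fun x => U (b + x)) U fun x => rfl]
  have heU (b) : e * U b = e := by
    rw [he, smul_mul_assoc, Finset.sum_mul]
    simp only [← AddChar.map_add_eq_mul]
    rw [Fintype.sum_equiv (Equiv.addRight b) (fun x => U (x + b)) U fun x => rfl]
  have hee : e * e = e := by
    nth_rewrite 1 [he]
    rw [smul_mul_assoc, Finset.sum_mul]
    simp only [hUe, Finset.sum_const, Finset.card_univ, ZMod.card]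
    rw [← Nat.cast_smul_eq_nsmul F, smul_smul, inv_mul_cancel₀ hl, one_smul]
  have hVe (a) : V a * e = (l : F)⁻¹ • ∑ b, χ (a * b) • (U b * V a) := by
    rw [he, mul_smul_comm, Finset.mul_sum]
    simp only [hUV]
  clear_value e
  have heVe (a : ZMod l) (ha : a ≠ 0) : e * V a * e = 0 := by
    have hne : ∃ b, χ (a * b) ≠ 1 := by
      by_contra! h
      exact hχ ha (by ext b; simpa using h b)
    obtain ⟨b, hb⟩ := hne
    have h1 : e * V a * e = χ (a * b) • (e * V a * e) := by
      calc e * V a * e = e * (V a * U b) * e := by rw [← mul_assoc, mul_assoc (e * V a), hUe]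
        _ = _ := by rw [hUV, mul_smul_comm, ← mul_assoc, heU, smul_mul_assoc]
    have h2 : (1 - χ (a * b)) • (e * V a * e) = 0 := by rw [sub_smul, one_smul, ← h1, sub_self]
    exact (smul_eq_zero.mp h2).resolve_left (sub_ne_zero.mpr hb.symm)
  have hV (a) : V a * V (-a) = 1 := by
    rw [← AddChar.map_add_eq_mul, add_neg_cancel, AddChar.map_zero_eq_one]
  have hdiag (a) : V a * e * V (-a) = (l : F)⁻¹ • ∑ b, χ (a * b) • U b := by
    rw [hVe, smul_mul_assoc, Finset.sum_mul]
    simp only [smul_mul_assoc, mul_assoc, hV, mul_one]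
  have hmul (i j k m : ZMod l) : V i * e * V (-j) * (V k * e * V (-m)) =
      if j = k then V i * e * V (-m) else 0 := by
    have h : V i * e * V (-j) * (V k * e * V (-m)) = V i * (e * V (-j + k) * e) * V (-m) := by
      rw [AddChar.map_add_eq_mul]; simp only [mul_assoc]
    rw [h]
    split_ifs with hjk
    · rw [hjk, neg_add_cancel, AddChar.map_zero_eq_one, mul_one, hee]
    · rw [heVe _ (by rwa [ne_eq, neg_add_eq_zero]), mul_zero, zero_mul]
  have hone : ∑ i, V i * e * V (-i) = 1 := by
    simp only [hdiag]
    rw [← Finset.smul_sum, Finset.sum_comm]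
    simp only [← Finset.sum_smul, AddChar.sum_mulShift _ hχ]
    simp [ite_smul, AddChar.map_zero_eq_one, hl]
  obtain ⟨f, hf⟩ := exists_algHom_of_matrixUnits (F := F) (fun i j => V i * e * V (-j)) hmul hone
  have hfE (i j) : V i * e * V (-j) ∈ f.range :=
    ⟨Matrix.single i j 1, by simp [hf, Matrix.single_apply, ite_and, ite_smul]⟩
  refine ⟨f, fun a => ⟨?_, ?_⟩, fun z hz M => ?_⟩
  · rw [← mul_one (U a), ← hone, Finset.mul_sum]
    refine Subalgebra.sum_mem _ fun i _ => ?_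
    have h : U a * (V i * e * V (-i)) = χ (-(i * a)) • (V i * e * V (-i)) := by
      have h1 : V i * e * V (-i) = χ (i * a) • (U a * (V i * e * V (-i))) := by
        calc V i * e * V (-i) = V i * U a * e * V (-i) := by rw [mul_assoc (V i) (U a), hUe]
          _ = _ := by rw [hUV]; simp only [smul_mul_assoc, mul_assoc]
      conv_rhs => rw [h1]
      rw [smul_smul, ← AddChar.map_add_eq_mul, neg_add_cancel, AddChar.map_zero_eq_one, one_smul]
    rw [h]
    exact Subalgebra.smul_mem _ (hfE i i) _
  · rw [← mul_one (V a), ← hone, Finset.mul_sum]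
    refine Subalgebra.sum_mem _ fun i _ => ?_
    rw [← mul_assoc, ← mul_assoc, ← AddChar.map_add_eq_mul]
    exact hfE _ _
  · have hze : Commute z e := he ▸ (Commute.sum_right _ _ _ fun b _ => (hz b).1).smul_right _
    rw [hf]
    exact Commute.sum_right _ _ _ fun i _ => Commute.sum_right _ _ _ fun j _ =>
      ((((hz i).2.mul_right hze).mul_right (hz (-j)).2)).smul_right _

theorem mul_pow_left_of_mul_eq_smul {F A : Type*} [Field F] [Ring A] [Algebra F A] {q : F} {u v : A}
    (h : v * u = q • (u * v)) (n : ℕ) : v ^ n * u = q ^ n • (u * v ^ n) := by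
  induction n with
  | zero => simp
  | succ n ih =>
    rw [pow_succ, mul_assoc, h, mul_smul_comm, ← mul_assoc, ih, smul_mul_assoc, smul_smul,
      mul_assoc, pow_succ q, mul_comm q]

theorem mul_pow_right_of_mul_eq_smul {F A : Type*} [Field F] [Ring A] [Algebra F A] {q : F}
    {u v : A} (h : v * u = q • (u * v)) (n : ℕ) : v * u ^ n = q ^ n • (u ^ n * v) := by
  induction n with
  | zero => simp
  | succ n ih =>
    rw [pow_succ, ← mul_assoc, ih, smul_mul_assoc, mul_assoc, h, mul_smul_comm, smul_smul,
      mul_assoc, pow_succ q]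

theorem exists_mul_pow_eq_smul {F A : Type*} [Field F] [Ring A] [Algebra F A] {q : F}
    (hq : q ≠ 0) {u v : A} (h : v * u = q • (u * v)) (n : ℕ) :
    ∃ c : F, c ≠ 0 ∧ (u * v) ^ n = c • (u ^ n * v ^ n) := by
  induction n with
  | zero => exact ⟨1, one_ne_zero, by simp⟩
  | succ n ih =>
    obtain ⟨c, hc, ih⟩ := ih
    refine ⟨c * q ^ n, mul_ne_zero hc (pow_ne_zero _ hq), ?_⟩
    rw [pow_succ, ih, smul_mul_assoc, mul_assoc, ← mul_assoc (v ^ n),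
      mul_pow_left_of_mul_eq_smul h, smul_mul_assoc, mul_smul_comm, smul_smul, pow_succ, pow_succ]
    simp only [mul_assoc]

/-- The powers of an element of order dividing `l`, as a character of `ℤ/l`. -/
def zmodPowChar {A : Type*} [Monoid A] (l : ℕ) [NeZero l] (u : A) (hu : u ^ l = 1) :
    AddChar (ZMod l) A where
  toFun a := u ^ a.val
  map_zero_eq_one' := by simp
  map_add_eq_mul' a b := by rw [ZMod.val_add, ← pow_eq_pow_mod _ hu, pow_add]

theorem exists_algHom_of_pow_eq_one {F A : Type*} [Field F] [Ring A] [Algebra F A] {l : ℕ}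
    (hl : 1 < l) (hchar : (l : F) ≠ 0) {ξ : F} (hξ : IsPrimitiveRoot ξ l) {u v : A}
    (hu : u ^ l = 1) (hv : v ^ l = 1) (h : v * u = ξ • (u * v)) :
    ∃ f : Matrix (Fin l) (Fin l) F →ₐ[F] A, (u ∈ f.range ∧ v ∈ f.range) ∧
      ∀ z, Commute z u → Commute z v → ∀ M, Commute z (f M) := by
  have : NeZero l := ⟨by omega⟩
  have : Fact (1 < l) := ⟨hl⟩
  obtain ⟨f, hf, hz⟩ := exists_algHom_of_addChar hchar
    (AddChar.zmodChar l hξ.pow_eq_one) (AddChar.zmodChar_primitive_of_primitive_root l hξ)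
    (zmodPowChar l u hu) (zmodPowChar l v hv) (fun a b => by
      change v ^ a.val * u ^ b.val = _ • (u ^ b.val * v ^ a.val)
      rw [AddChar.zmodChar_apply, ZMod.val_mul, ← pow_eq_pow_mod _ hξ.pow_eq_one, pow_mul]
      exact mul_pow_right_of_mul_eq_smul (mul_pow_left_of_mul_eq_smul h _) _)
  let r := Matrix.reindexAlgEquiv F F (Fintype.equivOfCardEq (by simp) : Fin l ≃ ZMod l)
  have hone : ∀ (w : A) (hw : w ^ l = 1), zmodPowChar l w hw 1 = w := fun w hw => by
    change w ^ (1 : ZMod l).val = w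
    rw [ZMod.val_one, pow_one]
  refine ⟨f.comp r.toAlgHom, ⟨?_, ?_⟩, fun z hu' hv' M => hz z (fun a => ⟨?_, ?_⟩) _⟩
  · obtain ⟨M, hM⟩ := (hf 1).1
    exact ⟨r.symm M, by simpa [hone] using hM⟩
  · obtain ⟨M, hM⟩ := (hf 1).2
    exact ⟨r.symm M, by simpa [hone] using hM⟩
  · exact hu'.pow_right _
  · exact hv'.pow_right _

theorem exists_algHom_of_pow_eq_smul_one {F A : Type*} [Field F] [IsAlgClosed F] [Ring A]
    [Algebra F A] {l : ℕ} (hl : 1 < l) (hchar : (l : F) ≠ 0) {ξ : F} (hξ : IsPrimitiveRoot ξ l)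
    {u v : A} (hu : ∃ c : F, c ≠ 0 ∧ u ^ l = c • 1) (hv : ∃ c : F, c ≠ 0 ∧ v ^ l = c • 1)
    (h : v * u = ξ • (u * v)) :
    ∃ f : Matrix (Fin l) (Fin l) F →ₐ[F] A, (u ∈ f.range ∧ v ∈ f.range) ∧
      ∀ z, Commute z u → Commute z v → ∀ M, Commute z (f M) := by
  have hroot : ∀ w : A, (∃ c : F, c ≠ 0 ∧ w ^ l = c • 1) →
      ∃ d : F, d ≠ 0 ∧ (d • w) ^ l = 1 := by
    rintro w ⟨c, hc, hw⟩
    obtain ⟨d, hd⟩ := IsAlgClosed.exists_pow_nat_eq c⁻¹ (by omega : 0 < l)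
    refine ⟨d, ?_, by rw [smul_pow, hd, hw, smul_smul, inv_mul_cancel₀ hc, one_smul]⟩
    rintro rfl
    rw [zero_pow (by omega)] at hd
    exact inv_ne_zero hc hd.symm
  obtain ⟨c, hc, hu⟩ := hroot u hu
  obtain ⟨d, hd, hv⟩ := hroot v hv
  obtain ⟨f, ⟨hfu, hfv⟩, hz⟩ := exists_algHom_of_pow_eq_one hl hchar hξ hu hv (by
    simp only [smul_mul_assoc, mul_smul_comm, h, smul_smul]
    congr 1
    ring)
  refine ⟨f, ⟨?_, ?_⟩, fun z hzu hzv => hz z (hzu.smul_right c) (hzv.smul_right d)⟩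
  · simpa [smul_smul, inv_mul_cancel₀ hc] using Subalgebra.smul_mem _ hfu c⁻¹
  · simpa [smul_smul, inv_mul_cancel₀ hd] using Subalgebra.smul_mem _ hfv d⁻¹

/-- Two commuting homomorphisms from matrix algebras factor through a larger matrix algebra. -/
theorem exists_algHom_matrix_mul {F A : Type*} [Field F] [Ring A] [Algebra F A] {m n k : ℕ}
    (hk : m * n = k) (f : Matrix (Fin m) (Fin m) F →ₐ[F] A) (g : Matrix (Fin n) (Fin n) F →ₐ[F] A)
    (hfg : ∀ M N, Commute (f M) (g N)) :
    ∃ h : Matrix (Fin k) (Fin k) F →ₐ[F] A, (f.range ≤ h.range ∧ g.range ≤ h.range) ∧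
      ∀ z, (∀ M, Commute z (f M)) → (∀ N, Commute z (g N)) → ∀ M, Commute z (h M) := by
  let r := (Matrix.kroneckerAlgEquiv (Fin m) (Fin n) F).trans
    (Matrix.reindexAlgEquiv F F (Fintype.equivOfCardEq (by simp [hk]) : Fin m × Fin n ≃ Fin k))
  let t := Algebra.TensorProduct.lift f g hfg
  have ht : ∀ x, t.comp r.symm.toAlgHom (r x) = t x := fun x => by simp
  refine ⟨t.comp r.symm.toAlgHom, ⟨?_, ?_⟩, fun z hzf hzg M => ?_⟩
  · rintro _ ⟨M, rfl⟩
    exact ⟨r (M ⊗ₜ 1), by simp [t]⟩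
  · rintro _ ⟨M, rfl⟩
    exact ⟨r (1 ⊗ₜ M), by simp [t]⟩
  · obtain ⟨x, rfl⟩ := r.surjective M
    rw [ht]
    induction x with
    | zero => simp
    | tmul x y => exact (hzf x).mul_right (hzg y)
    | add x y hx hy => rw [map_add]; exact hx.add_right hy

theorem exists_algHom_of_list {F A : Type*} [Field F] [IsAlgClosed F] [Ring A]
    [Algebra F A] {l : ℕ} (hl : 1 < l) (hchar : (l : F) ≠ 0) {ξ : F} (hξ : IsPrimitiveRoot ξ l)
    (m : ℕ) (L : List A) (hL : L.length = 2 * m)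
    (hpow : ∀ a ∈ L, ∃ c : F, c ≠ 0 ∧ a ^ l = c • 1)
    (hcomm : L.Pairwise fun a b => b * a = ξ • (a * b)) :
    ∃ f : Matrix (Fin (l ^ m)) (Fin (l ^ m)) F →ₐ[F] A, (∀ a ∈ L, a ∈ f.range) ∧
      ∀ z, (∀ a ∈ L, Commute z a) → ∀ M, Commute z (f M) := by
  induction m generalizing L with
  | zero =>
    obtain rfl : L = [] := by simpa using hL
    have : Subsingleton (Fin (l ^ 0)) := by rw [pow_zero]; infer_instance
    obtain ⟨f, hf⟩ := exists_algHom_of_matrixUnits (F := F) (fun _ _ : Fin (l ^ 0) => (1 : A))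
      (fun i j k m => by rw [if_pos (Subsingleton.elim j k), one_mul])
      (by rw [Finset.sum_const, Finset.card_univ, Fintype.card_fin, pow_zero, one_smul])
    refine ⟨f, by simp, fun z _ M => ?_⟩
    rw [hf]
    exact Commute.sum_right _ _ _ fun _ _ => Commute.sum_right _ _ _ fun _ _ =>
      (Commute.one_right z).smul_right _
  | succ m ih =>
    match L, hL with
    | u :: v :: L, hL =>
    have hLm : L.length = 2 * m := by simp at hL; omega
    obtain ⟨hu, hv, hcomm⟩ : (∀ a ∈ v :: L, a * u = ξ • (u * a)) ∧
        (∀ a ∈ L, a * v = ξ • (v * a)) ∧ L.Pairwise fun a b => b * a = ξ • (a * b) := by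
      simpa only [List.pairwise_cons] using hcomm
    have hvu := hu v (by simp)
    replace hu : ∀ a ∈ L, a * u = ξ • (u * a) := fun a ha => hu a (by simp [ha])
    have hξ0 : ξ ≠ 0 := hξ.ne_zero (by omega)
    have hξl : ξ ^ (l - 1) * ξ = 1 := by
      rw [← pow_succ, Nat.sub_add_cancel hl.le, hξ.pow_eq_one]
    have hpu := hpow u (by simp)
    have hpv := hpow v (by simp)
    replace hpow : ∀ a ∈ L, ∃ c : F, c ≠ 0 ∧ a ^ l = c • 1 := fun a ha => hpow a (by simp [ha])
    have hvl : v * v ^ (l - 1) = v ^ (l - 1) * v := (Commute.self_pow v _).eq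
    set v' := v ^ (l - 1) with hv'
    have hv'u : v' * u = ξ ^ (l - 1) • (u * v') := mul_pow_left_of_mul_eq_smul hvu _
    have huv' : u * v' = ξ • (v' * u) := by rw [hv'u, smul_smul, mul_comm, hξl, one_smul]
    have hav' (a) (ha : a ∈ L) : a * v' = ξ ^ (l - 1) • (v' * a) :=
      mul_pow_right_of_mul_eq_smul (hv a ha) _
    set t := v' * u with ht
    have hta (a) (ha : a ∈ L) : Commute t a := by
      change t * a = a * t
      rw [ht, ← mul_assoc, hav' a ha, smul_mul_assoc, mul_assoc v' a, hu a ha, mul_smul_comm,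
        smul_smul, hξl, one_smul, mul_assoc]
    have htu : u * t = ξ • (t * u) := by
      rw [ht, ← mul_assoc, huv', smul_mul_assoc]
    have htv : v * t = ξ • (t * v) := by
      rw [ht, ← mul_assoc, hvl, mul_assoc, hvu, mul_smul_comm, mul_assoc]
    obtain ⟨c, hc, htl⟩ : ∃ c : F, c ≠ 0 ∧ t ^ l = c • 1 := by
      obtain ⟨c, hc, h⟩ := exists_mul_pow_eq_smul hξ0 huv' l
      obtain ⟨d, hd, hu⟩ := hpu
      obtain ⟨e, he, hv⟩ := hpv
      refine ⟨c * (e ^ (l - 1) * d), by positivity, ?_⟩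
      rw [h, hu, hv', ← pow_mul, mul_comm, pow_mul, hv, smul_pow, one_pow, smul_mul_smul_comm,
        one_mul, smul_smul]
    obtain ⟨g, ⟨hgu, hgv⟩, hgz⟩ := exists_algHom_of_pow_eq_smul_one hl hchar hξ hpu hpv hvu
    obtain ⟨f, hfL, hfz⟩ := ih (L.map (t * ·)) (by simpa using hLm) (by
      simp only [List.mem_map]
      rintro _ ⟨a, ha, rfl⟩
      obtain ⟨d, hd, h⟩ := hpow a ha
      exact ⟨c * d, mul_ne_zero hc hd, by
        rw [(hta a ha).mul_pow, htl, h, smul_mul_smul_comm, one_mul]⟩) (by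
      rw [List.pairwise_map]
      refine hcomm.imp_of_mem fun {a b} ha hb hab => ?_
      rw [mul_assoc, ← mul_assoc b, ← (hta b hb).eq, mul_assoc t b, hab, mul_assoc t a,
        ← mul_assoc a, ← (hta a ha).eq, mul_assoc t a]
      simp only [mul_smul_comm])
    have hcom (w : A) (hw : w * t = ξ • (t * w)) (hwL : ∀ a ∈ L, a * w = ξ • (w * a)) (M) :
        Commute w (f M) := by
      refine hfz w (fun b hb => ?_) M
      obtain ⟨a, ha, rfl⟩ := List.mem_map.mp hb
      change w * (t * a) = t * a * w
      rw [mul_assoc t, hwL a ha, ← mul_assoc, hw, smul_mul_assoc, mul_smul_comm, mul_assoc]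
    obtain ⟨h, ⟨hf, hg⟩, hz⟩ := exists_algHom_matrix_mul (pow_succ l m).symm f g fun M N =>
      hgz _ (hcom u htu hu M).symm (hcom v htv hv M).symm N
    have htr : t ∈ h.range := h.range.mul_mem (h.range.pow_mem (hg hgv) _) (hg hgu)
    refine ⟨h, fun a ha => ?_, fun z hzL => ?_⟩
    · rcases List.mem_cons.mp ha with rfl | ha
      · exact hg hgu
      rcases List.mem_cons.mp ha with rfl | ha
      · exact hg hgv
      have hta' : t * a ∈ h.range := hf (hfL _ (List.mem_map_of_mem ha))
      have : a = c⁻¹ • (t ^ (l - 1) * (t * a)) := by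
        rw [← mul_assoc, ← pow_succ, Nat.sub_add_cancel hl.le, htl, smul_mul_assoc, one_mul,
          smul_smul, inv_mul_cancel₀ hc, one_smul]
      rw [this]
      exact h.range.smul_mem (h.range.mul_mem (h.range.pow_mem htr _) hta') _
    · have hzu : Commute z u := hzL u (by simp)
      have hzv : Commute z v := hzL v (by simp)
      refine hz z (hfz z fun b hb => ?_) (hgz z hzu hzv)
      obtain ⟨a, ha, rfl⟩ := List.mem_map.mp hb
      exact ((hzv.pow_right _).mul_right hzu).mul_right (hzL a (by simp [ha]))

/-- A unital homomorphism of matrix algebras `M_d(F) → M_n(F)` exists only if `d ∣ n`. -/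
theorem dvd_of_matrix_algHom {F : Type*} [Field F] {d n : ℕ} (hd : 0 < d)
    (f : Matrix (Fin d) (Fin d) F →ₐ[F] Matrix (Fin n) (Fin n) F) : d ∣ n := by
  have : NeZero d := ⟨hd.ne'⟩
  let g : Matrix (Fin d) (Fin d) F →ₐ[F] Module.End F (Fin n → F) :=
    (Matrix.toLinAlgEquiv' : Matrix (Fin n) (Fin n) F ≃ₐ[F] _).toAlgHom.comp f
  let E : Fin d → Fin d → Module.End F (Fin n → F) := fun i j => g (Matrix.single i j 1)
  have hmul (i j k m) : E i j * E k m = if j = k then E i m else 0 := by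
    simp only [E, ← map_mul]
    split_ifs with h
    · simp [h]
    · simp [h]
  have hmul' (i j k m v) : E i j (E k m v) = if j = k then E i m v else 0 := by
    rw [← Module.End.mul_apply, hmul]
    split_ifs <;> rfl
  have hone (v) : ∑ i, E i i v = v := by
    have h : ∑ i, E i i = 1 := by
      simp only [E, ← map_sum]
      rw [← map_one g]
      congr 1
      ext a b
      simp [Matrix.sum_apply, Matrix.single_apply, Matrix.one_apply, ite_and]
    rw [← LinearMap.sum_apply, h, Module.End.one_apply]
  let e : (Fin n → F) ≃ₗ[F] (Fin d → LinearMap.range (E 0 0)) :=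
    { toFun := fun v i => ⟨E 0 i v, E 0 i v, by rw [hmul', if_pos rfl]⟩
      map_add' := fun v w => by ext; simp
      map_smul' := fun c v => by ext; simp
      invFun := fun w => ∑ i, E i 0 (w i)
      left_inv := fun v => by simp [hmul', hone]
      right_inv := fun w => by
        funext i
        obtain ⟨x, hx⟩ := (w i).2
        ext1
        simp only [map_sum, hmul', Finset.sum_ite_eq, Finset.mem_univ, if_true]
        rw [← hx, hmul', if_pos rfl] }
  have h := e.finrank_eq
  rw [Module.finrank_fin_fun, Module.finrank_pi_fintype, Finset.sum_const, Finset.card_univ,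
    Fintype.card_fin, smul_eq_mul] at h
  exact ⟨_, h⟩

namespace Clg

variable {F : Type*} [Field F] {l : ℕ} {ξ : F} {I : Type*} [LinearOrder I]

/-- The generators of the generalized Clifford algebra. -/
noncomputable def gen (F : Type*) [Field F] (l : ℕ) (ξ : F) {I : Type*} [LinearOrder I] (i : I) :
    Clg F l ξ I :=
  RingQuot.mkAlgHom F (ClgRel F l ξ) (FreeAlgebra.ι F i)

theorem gen_pow (i : I) : gen F l ξ i ^ l = 1 := by
  rw [gen, ← map_pow, RingQuot.mkAlgHom_rel F (ClgRel.pow i), map_one]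

theorem gen_mul_gen {i j : I} (hij : i < j) :
    gen F l ξ j * gen F l ξ i = ξ • (gen F l ξ i * gen F l ξ j) := by
  simp only [gen]
  rw [← map_mul, RingQuot.mkAlgHom_rel F (ClgRel.comm hij), map_smul, map_mul]

theorem exists_finset_mem_adjoin [DecidableEq I] (a : Clg F l ξ I) :
    ∃ J : Finset I, a ∈ Algebra.adjoin F (gen F l ξ '' (J : Set I)) := by
  obtain ⟨x, rfl⟩ := RingQuot.mkAlgHom_surjective F (ClgRel F l ξ) a
  have hmono {J K : Finset I} (h : J ⊆ K) :
      Algebra.adjoin F (gen F l ξ '' (J : Set I)) ≤ Algebra.adjoin F (gen F l ξ '' (K : Set I)) :=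
    Algebra.adjoin_mono (Set.image_mono (Finset.coe_subset.mpr h))
  induction x with
  | grade0 r => exact ⟨∅, by rw [AlgHom.commutes]; exact Subalgebra.algebraMap_mem _ r⟩
  | grade1 i => exact ⟨{i}, Algebra.subset_adjoin ⟨i, by simp, rfl⟩⟩
  | mul a b ha hb =>
    obtain ⟨J, hJ⟩ := ha
    obtain ⟨K, hK⟩ := hb
    exact ⟨J ∪ K, by
      rw [map_mul]
      exact Subalgebra.mul_mem _ (hmono Finset.subset_union_left hJ)
        (hmono Finset.subset_union_right hK)⟩
  | add a b ha hb =>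
    obtain ⟨J, hJ⟩ := ha
    obtain ⟨K, hK⟩ := hb
    exact ⟨J ∪ K, by
      rw [map_add]
      exact Subalgebra.add_mem _ (hmono Finset.subset_union_left hJ)
        (hmono Finset.subset_union_right hK)⟩

/-- Any finite set of elements of `Clg F l ξ I` lies in the image of `M_{l^m}(F)` for some `m`, and
`m` can be taken arbitrarily large. -/
theorem exists_algHom_subset_range [IsAlgClosed F] [Infinite I] (hl : 1 < l) (hchar : (l : F) ≠ 0)
    (hξ : IsPrimitiveRoot ξ l) (s : Set (Clg F l ξ I)) (hs : s.Finite) (k : ℕ) :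
    ∃ m ≥ k, ∃ f : Matrix (Fin (l ^ m)) (Fin (l ^ m)) F →ₐ[F] Clg F l ξ I, s ⊆ f.range := by
  choose J hJ using exists_finset_mem_adjoin (F := F) (l := l) (ξ := ξ) (I := I)
  let K := hs.toFinset.biUnion J
  obtain ⟨K', hK, hcard⟩ := Infinite.exists_superset_card_eq K (2 * (K.card + k)) (by omega)
  obtain ⟨f, hf, -⟩ := exists_algHom_of_list hl hchar hξ (K.card + k)
    (K'.sort.map (gen F l ξ)) (by simp [hcard]) (by
      simp only [List.mem_map]
      rintro _ ⟨i, -, rfl⟩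
      exact ⟨1, one_ne_zero, by rw [gen_pow, one_smul]⟩) (by
      rw [List.pairwise_map]
      exact K'.sortedLT_sort.pairwise.imp gen_mul_gen)
  refine ⟨K.card + k, by omega, f, fun a ha => ?_⟩
  refine Algebra.adjoin_le ?_ (hJ a)
  rintro _ ⟨i, hi, rfl⟩
  exact hf _ (List.mem_map_of_mem ((Finset.mem_sort _).mpr
    (hK (Finset.mem_biUnion.mpr ⟨a, hs.mem_toFinset.mpr ha, hi⟩))))

/-- The sum of the coordinates with index larger than `i`. -/
noncomputable def upperSum (l : ℕ) (i : I) : (I →₀ ZMod l) →+ ZMod l :=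
  Finsupp.liftAddHom fun j => if i < j then AddMonoidHom.id _ else 0

theorem upperSum_single (i j : I) (c : ZMod l) :
    upperSum l i (Finsupp.single j c) = if i < j then c else 0 := by
  rw [upperSum, Finsupp.liftAddHom_apply_single]
  split_ifs <;> rfl

/-- The action of the `i`-th generator on functions on `⨁ᵢ ℤ/l`: a translation combined with a
multiplication by a character. -/
noncomputable def genRep (χ : AddChar (ZMod l) F) (i : I) : Module.End F ((I →₀ ZMod l) → F) where
  toFun φ a := χ (upperSum l i a) * φ (a + Finsupp.single i 1)
  map_add' φ ψ := by ext; simp [mul_add]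
  map_smul' c φ := by ext; simp [mul_left_comm]

theorem genRep_apply (χ : AddChar (ZMod l) F) (i : I) (φ : (I →₀ ZMod l) → F) (a : I →₀ ZMod l) :
    genRep χ i φ a = χ (upperSum l i a) * φ (a + Finsupp.single i 1) := rfl

theorem genRep_pow_apply (χ : AddChar (ZMod l) F) (i : I) (n : ℕ) (φ : (I →₀ ZMod l) → F)
    (a : I →₀ ZMod l) :
    (genRep χ i ^ n) φ a = χ (upperSum l i a) ^ n * φ (a + Finsupp.single i (n : ZMod l)) := by
  induction n generalizing a with
  | zero => simp
  | succ n ih =>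
    rw [pow_succ', Module.End.mul_apply, genRep_apply, ih, map_add, upperSum_single,
      if_neg (lt_irrefl i), add_zero, add_assoc, ← Finsupp.single_add, ← mul_assoc, ← pow_succ',
      Nat.cast_succ, add_comm (1 : ZMod l)]

theorem genRep_pow (χ : AddChar (ZMod l) F) (i : I) : genRep χ i ^ l = 1 := by
  ext φ a
  rw [genRep_pow_apply, ← AddChar.map_nsmul_eq_pow]
  simp

theorem genRep_mul_genRep (χ : AddChar (ZMod l) F) {i j : I} (hij : i < j) :
    genRep χ j * genRep χ i = χ 1 • (genRep χ i * genRep χ j) := by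
  ext φ a
  simp only [Module.End.mul_apply, LinearMap.smul_apply, Pi.smul_apply, smul_eq_mul, genRep_apply,
    map_add, upperSum_single, if_pos hij, if_neg hij.asymm, AddChar.map_add_eq_mul, add_zero,
    add_right_comm a (Finsupp.single i 1)]
  ring

theorem nontrivial (hl : 1 < l) (hξ : ξ ^ l = 1) : Nontrivial (Clg F l ξ I) := by
  have : NeZero l := ⟨by omega⟩
  have : Fact (1 < l) := ⟨hl⟩
  let χ := AddChar.zmodChar l hξ
  have hχ : χ 1 = ξ := by rw [AddChar.zmodChar_apply, ZMod.val_one, pow_one]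
  let ρ : FreeAlgebra F I →ₐ[F] Module.End F ((I →₀ ZMod l) → F) :=
    FreeAlgebra.lift F (genRep χ)
  have hρ : ∀ ⦃x y⦄, ClgRel F l ξ x y → ρ x = ρ y := by
    rintro _ _ (i | hij)
    · simp [ρ, genRep_pow]
    · simp [ρ, genRep_mul_genRep χ hij, hχ]
  exact (RingQuot.liftAlgHom F ⟨ρ, hρ⟩).toRingHom.domain_nontrivial

end Clg

theorem stmt_12 (F : Type*) [Field F] [IsAlgClosed F] (l : ℕ) (hl : 1 < l)
    (hchar : (l : F) ≠ 0) (ξ : F) (hξ : IsPrimitiveRoot ξ l)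
    (I : Type*) [LinearOrder I] [Infinite I] :
    IsLocallyMatrixAlgebra F (Clg F l ξ I) ∧
      matrixDegreeSet F (Clg F l ξ I) = {d | ∃ k : ℕ, d ∣ l ^ k} := by
  have hnt : Nontrivial (Clg F l ξ I) := Clg.nontrivial hl hξ.pow_eq_one
  have hinj {n : ℕ} (hn : 0 < n) (f : Matrix (Fin n) (Fin n) F →ₐ[F] Clg F l ξ I) :
      Function.Injective f := by
    have : NeZero n := ⟨hn.ne'⟩
    exact f.toRingHom.injective
  have hpos (m : ℕ) : 0 < l ^ m := pow_pos (by omega) m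
  refine ⟨fun s => ?_, Set.ext fun d => ⟨?_, ?_⟩⟩
  · obtain ⟨m, -, f, hf⟩ := Clg.exists_algHom_subset_range hl hchar hξ (s : Set (Clg F l ξ I))
      s.finite_toSet 0
    exact ⟨l ^ m, f.range, hpos m, hf, ⟨(AlgEquiv.ofInjective f (hinj (hpos m) f)).symm⟩⟩
  · rintro ⟨hd, S, ⟨e⟩⟩
    let g : Matrix (Fin d) (Fin d) F →ₐ[F] Clg F l ξ I := S.val.comp e.symm.toAlgHom
    obtain ⟨m, -, f, hf⟩ := Clg.exists_algHom_subset_range hl hchar hξ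
      (Set.range fun p : Fin d × Fin d => g (Matrix.single p.1 p.2 1)) (Set.finite_range _) 0
    have hg (M) : g M ∈ f.range := by
      rw [Matrix.matrix_eq_sum_single M]
      simp only [map_sum]
      refine sum_mem fun i _ => sum_mem fun j _ => ?_
      rw [← mul_one (M i j), ← smul_eq_mul, ← Matrix.smul_single, map_smul]
      exact f.range.smul_mem (hf ⟨(i, j), rfl⟩) _
    exact ⟨m, dvd_of_matrix_algHom hd
      ((AlgEquiv.ofInjective f (hinj (hpos m) f)).symm.toAlgHom.comp (g.codRestrict f.range hg))⟩
  · rintro ⟨k, hd⟩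
    obtain ⟨m, hm, f, -⟩ := Clg.exists_algHom_subset_range hl hchar hξ
      (∅ : Set (Clg F l ξ I)) Set.finite_empty k
    obtain ⟨n, hn⟩ := hd.trans (pow_dvd_pow l hm)
    have hd0 : 0 < d := Nat.pos_of_dvd_of_pos hd (hpos k)
    let r := (Matrix.kroneckerAlgEquiv (Fin d) (Fin n) F).trans
      (Matrix.reindexAlgEquiv F F
        (Fintype.equivOfCardEq (by simp [hn]) : Fin d × Fin n ≃ Fin (l ^ m)))
    let g := (f.comp r.toAlgHom).comp Algebra.TensorProduct.includeLeft
    exact ⟨hd0, g.range, ⟨(AlgEquiv.ofInjective g (hinj hd0 g)).symm⟩⟩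
end
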